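/- Suppose the ranges of T and of S are closed. Let H₀ be a normed space, ι : H₂ → H₀ a bounded linear map, and c > 0 a constant such that ‖v‖ ≤ c·‖ι v‖ for every v ∈ ℋ = ker S ∩ ker T*. Then there exists a constant C > 0 such that for every u ∈ dom S ∩ dom T*, ‖u‖² ≤ C·(‖Su‖² + ‖T*u‖² + ‖ι u‖²). -/

import Mathlib

/-- The kernel of a (partial) linear operator, as a submodule of the ambient domain space. -/
def LinearPMap.kerSubmodule {𝕜 E F : Type*} [RCLike 𝕜]
    [NormedAddCommGroup E] [InnerProductSpace 𝕜 E]
    [NormedAddCommGroup F] [InnerProductSpace 𝕜 F]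
    (S : E →ₗ.[𝕜] F) : Submodule 𝕜 E :=
  (LinearMap.ker S.toFun).map S.domain.subtype

/-- The range of a (partial) linear operator, as a submodule of the codomain. -/
def LinearPMap.rangeSubmodule {𝕜 E F : Type*} [RCLike 𝕜]
    [NormedAddCommGroup E] [InnerProductSpace 𝕜 E]
    [NormedAddCommGroup F] [InnerProductSpace 𝕜 F]
    (T : E →ₗ.[𝕜] F) : Submodule 𝕜 F :=
  LinearMap.range T.toFun

/-- Bounded preimages for a closed operator with closed range. -/
theorem LinearPMap.exists_preimage_bound {E F : Type*}
    [NormedAddCommGroup E] [InnerProductSpace ℂ E] [CompleteSpace E]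
    [NormedAddCommGroup F] [InnerProductSpace ℂ F] [CompleteSpace F]
    (P : E →ₗ.[ℂ] F) (hP : P.IsClosed) (hR : _root_.IsClosed (P.rangeSubmodule : Set F)) :
    ∃ K > (0 : ℝ), ∀ y ∈ P.rangeSubmodule, ∃ x : P.domain, P x = y ∧ ‖(x : E)‖ ≤ K * ‖y‖ := by
  have hG : _root_.IsClosed (P.graph : Set (E × F)) := hP
  haveI : CompleteSpace P.graph := hG.completeSpace_coe
  haveI : CompleteSpace P.rangeSubmodule := hR.completeSpace_coe
  let f : P.graph →L[ℂ] P.rangeSubmodule :=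
    ((ContinuousLinearMap.snd ℂ E F).comp P.graph.subtypeL).codRestrict P.rangeSubmodule (by
      rintro ⟨z, hz⟩
      obtain ⟨x, hx⟩ := (LinearPMap.mem_graph_iff P).1 hz
      exact ⟨x, hx.2⟩)
  have hf : Function.Surjective f := by
    rintro ⟨y, x, rfl⟩
    exact ⟨⟨((x : E), P x), P.mem_graph x⟩, rfl⟩
  obtain ⟨K, hK, h⟩ := f.exists_preimage_norm_le hf
  refine ⟨K, hK, fun y hy => ?_⟩
  obtain ⟨⟨z, hz⟩, h1, h2⟩ := h ⟨y, hy⟩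
  obtain ⟨x, hx1, hx2⟩ := (LinearPMap.mem_graph_iff P).1 hz
  refine ⟨x, ?_, ?_⟩
  · rw [hx2]; exact congrArg Subtype.val h1
  · rw [hx1]; exact (norm_fst_le z).trans h2

theorem LinearPMap.mem_kerSubmodule_iff' {E F : Type*}
    [NormedAddCommGroup E] [InnerProductSpace ℂ E]
    [NormedAddCommGroup F] [InnerProductSpace ℂ F]
    (P : E →ₗ.[ℂ] F) (x : E) : x ∈ P.kerSubmodule ↔ ∃ h : x ∈ P.domain, P ⟨x, h⟩ = 0 := by
  constructor
  · rintro ⟨z, hz, rfl⟩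
    exact ⟨z.2, hz⟩
  · rintro ⟨h, h0⟩
    exact ⟨⟨x, h⟩, h0, rfl⟩

theorem LinearPMap.isClosed_kerSubmodule {E F : Type*}
    [NormedAddCommGroup E] [InnerProductSpace ℂ E]
    [NormedAddCommGroup F] [InnerProductSpace ℂ F]
    (P : E →ₗ.[ℂ] F) (hP : P.IsClosed) : _root_.IsClosed (P.kerSubmodule : Set E) := by
  have hG : _root_.IsClosed (P.graph : Set (E × F)) := hP
  have : (P.kerSubmodule : Set E) = (fun x : E => (x, (0 : F))) ⁻¹' (P.graph : Set (E × F)) := by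
    ext x
    simp only [SetLike.mem_coe, Set.mem_preimage]
    rw [P.mem_kerSubmodule_iff', LinearPMap.mem_graph_iff]
    constructor
    · rintro ⟨h, h0⟩
      exact ⟨⟨x, h⟩, rfl, h0⟩
    · rintro ⟨z, rfl, h0⟩
      exact ⟨z.2, h0⟩
  rw [this]
  exact hG.preimage (by fun_prop)

theorem LinearPMap.mem_ker_adjoint {E F : Type*}
    [NormedAddCommGroup E] [InnerProductSpace ℂ E] [CompleteSpace E]
    [NormedAddCommGroup F] [InnerProductSpace ℂ F]
    (P : E →ₗ.[ℂ] F) (hP : Dense (P.domain : Set E)) (v : F)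
    (hv : ∀ x : P.domain, inner ℂ v (P x) = 0) : v ∈ P.adjoint.kerSubmodule := by
  have hd : v ∈ P.adjoint.domain :=
    P.mem_adjoint_domain_of_exists v ⟨0, fun x => by rw [hv x, inner_zero_left]⟩
  rw [P.adjoint.mem_kerSubmodule_iff']
  exact ⟨hd, LinearPMap.adjoint_apply_eq hP ⟨v, hd⟩ fun x => by rw [hv x, inner_zero_left]⟩

/-- If `z = y + n` with `z ⟂ n` then `‖z‖ ≤ ‖y‖`. -/
theorem norm_le_of_inner_sub_eq_zero {E : Type*}
    [NormedAddCommGroup E] [InnerProductSpace ℂ E] (z w : E)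
    (h : inner ℂ z (z - w) = 0) : ‖z‖ ≤ ‖w‖ := by
  rw [inner_sub_right, sub_eq_zero] at h
  have h1 : ‖z‖ * ‖z‖ ≤ ‖z‖ * ‖w‖ := by
    calc ‖z‖ * ‖z‖ = ‖inner ℂ z z‖ := by
          rw [inner_self_eq_norm_sq_to_K]; simp [sq]
      _ = ‖inner ℂ z w‖ := by rw [h]
      _ ≤ _ := norm_inner_le_norm _ _
  rcases (norm_nonneg z).eq_or_lt with h0 | h0
  · rw [← h0]; exact norm_nonneg _
  · exact le_of_mul_le_mul_left h1 h0

/-- If the ranges of `T` and `S` are closed and `‖v‖ ≤ c ‖ι v‖` on the harmonic space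
`ℋ = ker S ∩ ker T*`, then `‖u‖² ≤ C (‖Su‖² + ‖T*u‖² + ‖ι u‖²)` on `dom S ∩ dom T*`. -/
theorem basic_estimate_with_weak_norm
    {H₁ H₂ H₃ H₀ : Type*}
    [NormedAddCommGroup H₁] [InnerProductSpace ℂ H₁] [CompleteSpace H₁]
    [NormedAddCommGroup H₂] [InnerProductSpace ℂ H₂] [CompleteSpace H₂]
    [NormedAddCommGroup H₃] [InnerProductSpace ℂ H₃] [CompleteSpace H₃]
    [NormedAddCommGroup H₀] [NormedSpace ℂ H₀]
    (T : H₁ →ₗ.[ℂ] H₂) (S : H₂ →ₗ.[ℂ] H₃)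
    (hTdense : Dense (T.domain : Set H₁)) (hSdense : Dense (S.domain : Set H₂))
    (hTclosed : T.IsClosed) (hSclosed : S.IsClosed)
    (hTS : T.rangeSubmodule ≤ S.kerSubmodule)
    (hTrange : IsClosed (T.rangeSubmodule : Set H₂))
    (hSrange : IsClosed (S.rangeSubmodule : Set H₃))
    (ι : H₂ →L[ℂ] H₀) (c : ℝ) (hc : 0 < c)
    (hιest : ∀ v ∈ S.kerSubmodule ⊓ T.adjoint.kerSubmodule, ‖v‖ ≤ c * ‖ι v‖) :
    ∃ C > (0 : ℝ), ∀ u (hu : u ∈ S.domain) (hu' : u ∈ T.adjoint.domain),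
      ‖u‖ ^ 2 ≤ C * (‖S ⟨u, hu⟩‖ ^ 2 + ‖T.adjoint ⟨u, hu'⟩‖ ^ 2 + ‖ι u‖ ^ 2) := by
  obtain ⟨K, hK, hKT⟩ := T.exists_preimage_bound hTclosed hTrange
  obtain ⟨L, hL, hLS⟩ := S.exists_preimage_bound hSclosed hSrange
  haveI : CompleteSpace T.rangeSubmodule := hTrange.completeSpace_coe
  haveI : CompleteSpace S.kerSubmodule := (S.isClosed_kerSubmodule hSclosed).completeSpace_coe
  set M := ‖ι‖ with hM
  have hM0 : 0 ≤ M := norm_nonneg _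
  set A := (1 + c * M) * (K + L) + c with hA
  have hA0 : 0 < A := by positivity
  refine ⟨3 * A ^ 2, by positivity, fun u hu hu' => ?_⟩
  obtain ⟨p, hpR, hp⟩ : ∃ p ∈ T.rangeSubmodule, ∀ y ∈ T.rangeSubmodule, inner ℂ (u - p) y = 0 :=
    ⟨T.rangeSubmodule.starProjection u, Submodule.starProjection_apply_mem _ _,
      fun y hy => Submodule.starProjection_inner_eq_zero u y hy⟩
  obtain ⟨h, hhN, hh⟩ : ∃ h ∈ S.kerSubmodule, ∀ y ∈ S.kerSubmodule, inner ℂ (u - p - h) y = 0 :=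
    ⟨S.kerSubmodule.starProjection (u - p), Submodule.starProjection_apply_mem _ _,
      fun y hy => Submodule.starProjection_inner_eq_zero (u - p) y hy⟩
  -- estimate for p
  have hpn : ‖p‖ ≤ K * ‖T.adjoint ⟨u, hu'⟩‖ := by
    obtain ⟨x, hx, hxn⟩ := hKT p hpR
    have h1 : inner ℂ u p = inner ℂ p p := by
      have := hp p hpR
      rwa [inner_sub_left, sub_eq_zero] at this
    have h2 : inner ℂ (T.adjoint ⟨u, hu'⟩) (x : H₁) = inner ℂ u p := by
      rw [← hx]; exact LinearPMap.adjoint_isFormalAdjoint hTdense ⟨u, hu'⟩ x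
    have h3 : ‖p‖ * ‖p‖ ≤ ‖p‖ * (K * ‖T.adjoint ⟨u, hu'⟩‖) := by
      calc ‖p‖ * ‖p‖ = ‖inner ℂ p p‖ := by
            rw [inner_self_eq_norm_sq_to_K]; simp [sq]
        _ = ‖inner ℂ (T.adjoint ⟨u, hu'⟩) (x : H₁)‖ := by rw [h2, h1]
        _ ≤ ‖T.adjoint ⟨u, hu'⟩‖ * ‖(x : H₁)‖ := norm_inner_le_norm _ _
        _ ≤ ‖T.adjoint ⟨u, hu'⟩‖ * (K * ‖p‖) := by gcongr
        _ = _ := by ring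
    rcases (norm_nonneg p).eq_or_lt with h0 | h0
    · rw [← h0]; positivity
    · exact le_of_mul_le_mul_left h3 h0
  -- estimate for the coexact part
  have hqn : ‖u - p - h‖ ≤ L * ‖S ⟨u, hu⟩‖ := by
    obtain ⟨w, hw, hwn⟩ := hLS (S ⟨u, hu⟩) ⟨⟨u, hu⟩, rfl⟩
    refine le_trans (norm_le_of_inner_sub_eq_zero _ (w : H₂) (hh _ ?_)) hwn
    have huw : u - (w : H₂) ∈ S.kerSubmodule := by
      rw [S.mem_kerSubmodule_iff']
      refine ⟨S.domain.sub_mem hu w.2, ?_⟩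
      have := S.map_sub ⟨u, hu⟩ w
      rw [hw, sub_self] at this
      exact this
    have : u - p - h - (w : H₂) = (u - w) - p - h := by abel
    rw [this]
    exact Submodule.sub_mem _ (Submodule.sub_mem _ huw (hTS hpR)) hhN
  -- the harmonic part
  have hharm : h ∈ S.kerSubmodule ⊓ T.adjoint.kerSubmodule := by
    refine ⟨hhN, T.mem_ker_adjoint hTdense h fun x => ?_⟩
    have hx : T x ∈ T.rangeSubmodule := ⟨x, rfl⟩
    have h1 := hp _ hx
    have h2 := hh _ (hTS hx)
    rw [inner_sub_left, h1, zero_sub, neg_eq_zero] at h2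
    exact h2
  have hhn := hιest h hharm
  have hιh : ‖ι h‖ ≤ ‖ι u‖ + M * (‖p‖ + ‖u - p - h‖) := by
    have e : ι h = ι u - ι (p + (u - p - h)) := by
      rw [← map_sub]; congr 1; abel
    rw [e]
    refine (norm_sub_le _ _).trans ?_
    gcongr
    exact (ι.le_opNorm _).trans (by gcongr; exact norm_add_le _ _)
  have hun : ‖u‖ ≤ ‖p‖ + ‖u - p - h‖ + ‖h‖ := by
    have e : u = p + (u - p - h) + h := by abel
    calc ‖u‖ = ‖p + (u - p - h) + h‖ := by rw [← e]
      _ ≤ _ := norm_add₃_le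
  set s := ‖S ⟨u, hu⟩‖ with hs
  set t := ‖T.adjoint ⟨u, hu'⟩‖ with ht
  set d := ‖ι u‖ with hd
  have hs0 : 0 ≤ s := norm_nonneg _
  have ht0 : 0 ≤ t := norm_nonneg _
  have hd0 : 0 ≤ d := norm_nonneg _
  have hfin : ‖u‖ ≤ A * (s + t + d) := by
    calc ‖u‖ ≤ ‖p‖ + ‖u - p - h‖ + c * (d + M * (‖p‖ + ‖u - p - h‖)) := by
          refine hun.trans ?_
          gcongr
          exact hhn.trans (by gcongr)
      _ ≤ K * t + L * s + c * (d + M * (K * t + L * s)) := by gcongr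
      _ ≤ A * (s + t + d) := by
          have : A * (s + t + d) - (K * t + L * s + c * (d + M * (K * t + L * s)))
            = (1 + c * M) * (K * (s + d) + L * (t + d)) + c * (s + t) := by rw [hA]; ring
          have h2 : 0 ≤ (1 + c * M) * (K * (s + d) + L * (t + d)) + c * (s + t) := by positivity
          linarith
  calc ‖u‖ ^ 2 ≤ (A * (s + t + d)) ^ 2 := by gcongr
    _ = A ^ 2 * (s + t + d) ^ 2 := by ring
    _ ≤ A ^ 2 * (3 * (s ^ 2 + t ^ 2 + d ^ 2)) := by
        gcongr
        nlinarith [sq_nonneg (s - t), sq_nonneg (s - d), sq_nonneg (t - d)]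
    _ = _ := by ring
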